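/- Convergence of the proportional-integral joint-velocity error dynamics: let n ∈ ℕ, let K_P, K_I ∈ ℝ^{n×n} be symmetric positive definite, and let e, η : [0,∞) → ℝⁿ be differentiable with η′(t) = e(t) and e′(t) = −K_P e(t) − K_I η(t) for all t ≥ 0 (the closed loop obtained from the joint dynamics M̄ s̈ + b̄ = τ under the torque law τ = b̄ + M̄(K_P e + K_I ∫e) with constant desired joint velocity, where e = u₂* − ṡ). Then e(t) → 0 and η(t) → 0 as t → ∞. -/

import Mathlib

open Filter Matrix

/-- Action of an `n × n` real matrix on `ℝⁿ` (Euclidean space) by matrix–vector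
multiplication. -/
noncomputable def actn {n : ℕ} (K : Matrix (Fin n) (Fin n) ℝ)
    (x : EuclideanSpace ℝ (Fin n)) : EuclideanSpace ℝ (Fin n) :=
  Matrix.toEuclideanLin K x

open scoped RealInnerProductSpace

section Coercivity

variable {E : Type*} [NormedAddCommGroup E] [InnerProductSpace ℝ E]

/-- A positive definite operator on a finite-dimensional space is coercive. -/
lemma exists_pos_mul_sq_norm_le_inner [FiniteDimensional ℝ E] (T : E →L[ℝ] E)
    (hT : ∀ x, x ≠ 0 → 0 < ⟪x, T x⟫) : ∃ a > 0, ∀ x, a * ‖x‖ ^ 2 ≤ ⟪x, T x⟫ := by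
  have : ProperSpace E := FiniteDimensional.proper ℝ E
  obtain ⟨a, ha, hle⟩ := (isCompact_sphere (0 : E) 1).exists_forall_le'
    (f := fun x => ⟪x, T x⟫) (a := 0) (by fun_prop)
    fun x hx => hT x (ne_zero_of_mem_unit_sphere ⟨x, hx⟩)
  refine ⟨a, ha, fun x => ?_⟩
  rcases eq_or_ne x 0 with rfl | hx
  · simp
  have hx' : ‖x‖ ≠ 0 := norm_ne_zero_iff.mpr hx
  have h := hle (‖x‖⁻¹ • x) (by simp [norm_smul, hx'])
  simp only [map_smul, real_inner_smul_left, real_inner_smul_right] at h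
  calc a * ‖x‖ ^ 2 ≤ ‖x‖⁻¹ * (‖x‖⁻¹ * ⟪x, T x⟫) * ‖x‖ ^ 2 := by gcongr
    _ = ⟪x, T x⟫ := by field_simp

lemma inner_apply_le_opNorm_mul_sq (T : E →L[ℝ] E) (x : E) : ⟪x, T x⟫ ≤ ‖T‖ * ‖x‖ ^ 2 :=
  calc ⟪x, T x⟫ ≤ ‖x‖ * ‖T x‖ := real_inner_le_norm _ _
    _ ≤ ‖x‖ * (‖T‖ * ‖x‖) := by gcongr; exact T.le_opNorm x
    _ = ‖T‖ * ‖x‖ ^ 2 := by ring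

end Coercivity

/-- A function with `W' ≤ -c W` on `[0, ∞)` decays exponentially. -/
lemma le_mul_exp_of_hasDerivAt_le {W W' : ℝ → ℝ} {c : ℝ}
    (hW : ∀ t, 0 ≤ t → HasDerivAt W (W' t) t) (hle : ∀ t, 0 ≤ t → W' t ≤ -c * W t)
    {t : ℝ} (ht : 0 ≤ t) : W t ≤ W 0 * Real.exp (-(c * t)) := by
  have hd : ∀ s, 0 ≤ s → HasDerivAt (fun s => W s * Real.exp (c * s))
      (W' s * Real.exp (c * s) + W s * (Real.exp (c * s) * c)) s := fun s hs =>
    (hW s hs).mul (by simpa using ((hasDerivAt_id s).const_mul c).exp)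
  have hanti : AntitoneOn (fun s => W s * Real.exp (c * s)) (Set.Ici 0) := by
    refine antitoneOn_of_deriv_nonpos (convex_Ici 0)
      (fun s hs => (hd s hs).continuousAt.continuousWithinAt)
      (fun s hs => (hd s (interior_subset hs)).differentiableAt.differentiableWithinAt) ?_
    intro s hs
    have hs' : 0 ≤ s := interior_subset hs
    rw [(hd s hs').deriv]
    nlinarith [hle s hs', Real.exp_pos (c * s)]
  have h : W t * Real.exp (c * t) ≤ W 0 := by
    simpa using hanti Set.self_mem_Ici (Set.mem_Ici.mpr ht) ht
  rw [Real.exp_neg, ← div_eq_mul_inv]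
  exact (le_div_iff₀ (Real.exp_pos _)).mpr h

section SecondOrder

variable {E : Type*} [NormedAddCommGroup E] [InnerProductSpace ℝ E]

/-- Strict Lyapunov function for `η' = e`, `e' = -A e - B η`. -/
noncomputable def lyapunov (A B : E →L[ℝ] E) (ε : ℝ) (e η : E) : ℝ :=
  ⟪e, e⟫ + ⟪η, B η⟫ + 2 * ε * ⟪η, e⟫ + ε * ⟪η, A η⟫

lemma hasDerivAt_lyapunov {A B : E →L[ℝ] E} (hA : A.IsSymmetric) (hB : B.IsSymmetric)
    (ε : ℝ) {e η : ℝ → E} {t : ℝ} (hη : HasDerivAt η (e t) t)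
    (he : HasDerivAt e (-A (e t) - B (η t)) t) :
    HasDerivAt (fun s => lyapunov A B ε (e s) (η s))
      (-2 * ⟪e t, A (e t)⟫ + 2 * ε * ⟪e t, e t⟫ - 2 * ε * ⟪η t, B (η t)⟫) t := by
  have hAη := A.hasFDerivAt.comp_hasDerivAt t hη
  have hBη := B.hasFDerivAt.comp_hasDerivAt t hη
  refine ((((he.inner ℝ he).add (hη.inner ℝ hBη)).add ((hη.inner ℝ he).const_mul (2 * ε))).add
    ((hη.inner ℝ hAη).const_mul ε)).congr_deriv ?_
  have h₁ : ⟪η t, A (e t)⟫ = ⟪e t, A (η t)⟫ := by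
    rw [real_inner_comm]; exact hA _ _
  have h₂ : ⟪η t, B (e t)⟫ = ⟪e t, B (η t)⟫ := by
    rw [real_inner_comm]; exact hB _ _
  have h₃ : ⟪A (e t), e t⟫ = ⟪e t, A (e t)⟫ := real_inner_comm _ _
  have h₄ : ⟪B (η t), e t⟫ = ⟪e t, B (η t)⟫ := real_inner_comm _ _
  simp only [Function.comp_apply, inner_sub_left, inner_sub_right, inner_neg_left,
    inner_neg_right, h₁, h₂, h₃, h₄]
  ring

lemma le_lyapunov {A B : E →L[ℝ] E} {a b : ℝ} (ha : 0 < a)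
    (hA : ∀ x, a * ‖x‖ ^ 2 ≤ ⟪x, A x⟫) (hB : ∀ x, b * ‖x‖ ^ 2 ≤ ⟪x, B x⟫) (e η : E) :
    ‖e‖ ^ 2 / 2 + b * ‖η‖ ^ 2 ≤ lyapunov A B (a / 2) e η := by
  have h := neg_le_of_abs_le (abs_real_inner_le_norm η e)
  rw [lyapunov, real_inner_self_eq_norm_sq]
  nlinarith [hA η, hB η, sq_nonneg (‖e‖ - a * ‖η‖), mul_le_mul_of_nonneg_left h ha.le,
    mul_le_mul_of_nonneg_left (hA η) ha.le]

lemma lyapunov_le (A B : E →L[ℝ] E) {ε : ℝ} (hε : 0 ≤ ε) (e η : E) :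
    lyapunov A B ε e η ≤ (1 + ε + ‖B‖ + ε * ‖A‖) * (‖e‖ ^ 2 + ‖η‖ ^ 2) := by
  have h₁ := mul_le_mul_of_nonneg_left (inner_apply_le_opNorm_mul_sq A η) hε
  have h₂ := inner_apply_le_opNorm_mul_sq B η
  have h₃ : 2 * ⟪η, e⟫ ≤ ‖e‖ ^ 2 + ‖η‖ ^ 2 := by
    nlinarith [real_inner_le_norm η e, sq_nonneg (‖e‖ - ‖η‖)]
  have h₄ := mul_le_mul_of_nonneg_left h₃ hε
  have h₅ : 0 ≤ (‖B‖ + ε * ‖A‖) * ‖e‖ ^ 2 := by positivity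
  rw [lyapunov, real_inner_self_eq_norm_sq]
  nlinarith [sq_nonneg ‖η‖]

/-- The damped second-order system `η' = e`, `e' = -A e - B η` with `A`, `B` symmetric and
coercive is asymptotically stable. -/
theorem tendsto_zero_of_coercive {A B : E →L[ℝ] E} (hAs : A.IsSymmetric) (hBs : B.IsSymmetric)
    {a b : ℝ} (ha : 0 < a) (hb : 0 < b)
    (hA : ∀ x, a * ‖x‖ ^ 2 ≤ ⟪x, A x⟫) (hB : ∀ x, b * ‖x‖ ^ 2 ≤ ⟪x, B x⟫)
    {e η : ℝ → E} (hη : ∀ t, 0 ≤ t → HasDerivAt η (e t) t)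
    (he : ∀ t, 0 ≤ t → HasDerivAt e (-A (e t) - B (η t)) t) :
    Tendsto e atTop (nhds 0) ∧ Tendsto η atTop (nhds 0) := by
  set W : ℝ → ℝ := fun t => lyapunov A B (a / 2) (e t) (η t)
  set C : ℝ := 1 + a / 2 + ‖B‖ + a / 2 * ‖A‖
  have hC : 0 < C := by positivity
  set m : ℝ := min a (a * b)
  have hm : 0 < m := lt_min ha (mul_pos ha hb)
  have hdecay : ∀ t, 0 ≤ t → W t ≤ W 0 * Real.exp (-(m / C * t)) := fun t ht =>
    le_mul_exp_of_hasDerivAt_le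
      (fun s hs => hasDerivAt_lyapunov hAs hBs (a / 2) (hη s hs) (he s hs))
      (fun s _ => by
        have hW : m / C * W s ≤ m * (‖e s‖ ^ 2 + ‖η s‖ ^ 2) := by
          rw [div_mul_eq_mul_div, div_le_iff₀ hC, mul_assoc, mul_comm _ C]
          exact mul_le_mul_of_nonneg_left (lyapunov_le A B (by positivity) _ _) hm.le
        have h₁ : m * ‖e s‖ ^ 2 ≤ a * ‖e s‖ ^ 2 := by gcongr; exact min_le_left _ _
        have h₂ : m * ‖η s‖ ^ 2 ≤ a * b * ‖η s‖ ^ 2 := by gcongr; exact min_le_right _ _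
        have h₃ := mul_le_mul_of_nonneg_left (hB (η s)) ha.le
        rw [real_inner_self_eq_norm_sq]
        linarith [hA (e s)]) ht
  have hexp : Tendsto (fun t => W 0 * Real.exp (-(m / C * t))) atTop (nhds 0) := by
    simpa using (Real.tendsto_exp_neg_atTop_nhds_zero.comp
      (tendsto_id.const_mul_atTop (div_pos hm hC))).const_mul (W 0)
  have tendsto_of_sq_le : ∀ {f : ℝ → E} {k : ℝ}, 0 < k → (∀ t, k * ‖f t‖ ^ 2 ≤ W t) →
      Tendsto f atTop (nhds 0) := by
    intro f k hk hf
    have hsq : Tendsto (fun t => ‖f t‖ ^ 2) atTop (nhds 0) := by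
      refine squeeze_zero' (Eventually.of_forall fun t => sq_nonneg _) ?_
        (by simpa using hexp.const_mul k⁻¹)
      filter_upwards [eventually_ge_atTop 0] with t ht
      rw [← div_eq_inv_mul, le_div_iff₀' hk]
      exact (hf t).trans (hdecay t ht)
    exact tendsto_zero_iff_norm_tendsto_zero.mpr (by simpa using hsq.sqrt)
  have hlow := fun t => le_lyapunov ha hA hB (e t) (η t)
  constructor
  · refine tendsto_of_sq_le (k := 1 / 2) (by norm_num) fun t => ?_
    have : 0 ≤ b * ‖η t‖ ^ 2 := by positivity
    linarith [hlow t]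
  · refine tendsto_of_sq_le hb fun t => ?_
    linarith [hlow t, sq_nonneg ‖e t‖]

end SecondOrder

lemma Matrix.PosDef.inner_toEuclideanLin_pos {n : ℕ} {K : Matrix (Fin n) (Fin n) ℝ}
    (hK : K.PosDef) {x : EuclideanSpace ℝ (Fin n)} (hx : x ≠ 0) :
    0 < ⟪x, Matrix.toEuclideanLin K x⟫ := by
  have h := hK.dotProduct_mulVec_pos (x := x.ofLp) (by simpa using hx)
  simpa [EuclideanSpace.inner_eq_star_dotProduct, dotProduct_comm] using h

/-- Convergence of the proportional-integral joint-velocity error dynamics: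
if `η′ = e` and `e′ = −K_P e − K_I η` with `K_P, K_I` symmetric positive definite,
then `e(t) → 0` and `η(t) → 0` as `t → ∞`. -/
theorem PI_error_dynamics_converge
    (n : ℕ) (KP KI : Matrix (Fin n) (Fin n) ℝ)
    (hKP : KP.PosDef) (hKI : KI.PosDef)
    (e η : ℝ → EuclideanSpace ℝ (Fin n))
    (hη : ∀ t : ℝ, 0 ≤ t → HasDerivAt η (e t) t)
    (he : ∀ t : ℝ, 0 ≤ t → HasDerivAt e (-actn KP (e t) - actn KI (η t)) t) :
    Tendsto e atTop (nhds 0) ∧ Tendsto η atTop (nhds 0) := by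
  obtain ⟨a, ha, hA⟩ := exists_pos_mul_sq_norm_le_inner
    (LinearMap.toContinuousLinearMap (Matrix.toEuclideanLin KP))
    fun _ hx => hKP.inner_toEuclideanLin_pos hx
  obtain ⟨b, hb, hB⟩ := exists_pos_mul_sq_norm_le_inner
    (LinearMap.toContinuousLinearMap (Matrix.toEuclideanLin KI))
    fun _ hx => hKI.inner_toEuclideanLin_pos hx
  exact tendsto_zero_of_coercive (Matrix.isSymmetric_toEuclideanLin_iff.mpr hKP.isHermitian)
    (Matrix.isSymmetric_toEuclideanLin_iff.mpr hKI.isHermitian) ha hb hA hB hη he
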